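/- Let f ∈ Dom_+(Γ) with f → ∞, let p ≥ 2 and a > 0, and write A := {f ≤ a}. Assume f^p ∈ Dom_+(Γ) and that there exists c > 0 with Γf^p(x) ≤ −c·f(x)^{p−2} for all x ∉ A. Then there exists c' > 0 such that E_x(τ_A^q) ≤ c'·f(x)^{2q} for all 0 < q ≤ p/2 and all x ∈ 𝕏. -/

import Mathlib

open MeasureTheory Set Filter
open scoped Classical ENNReal NNReal

/-- A continuous-time Markov chain on a countably infinite state space `X`,
described by its generator `Γ`, together with a probability space carrying,
for each starting point `x`, the embedded jump chain `jump` and the holding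
times `hold` (with `hold n` the holding time at the `n`-th visited state). -/
structure CTMC where
  X : Type
  countX : Countable X
  infX : Infinite X
  Γ : X → X → ℝ
  γ : X → ℝ
  γ_pos : ∀ x, 0 < γ x
  Γ_offdiag_nonneg : ∀ x y, y ≠ x → 0 ≤ Γ x y
  Γ_diag : ∀ x, Γ x x = - γ x
  γ_sum : ∀ x, HasSum (fun y => if y = x then 0 else Γ x y) (γ x)
  /-- irreducibility of the embedded jump chain -/
  irr : ∀ x y : X, ∃ (n : ℕ) (path : ℕ → X), path 0 = x ∧ path n = y ∧
    ∀ k, k < n → 0 < (if path (k+1) = path k then 0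
      else Γ (path k) (path (k+1)) / γ (path k))
  Ω : Type
  measΩ : MeasurableSpace Ω
  μ : X → @Measure Ω measΩ
  probμ : ∀ x, @IsProbabilityMeasure Ω measΩ (μ x)
  jump : ℕ → Ω → X
  hold : ℕ → Ω → ℝ
  jump_meas : ∀ (n : ℕ) (x : X), MeasurableSet[measΩ] {ω | jump n ω = x}
  hold_meas : ∀ n : ℕ, @Measurable Ω ℝ measΩ _ (hold n)
  hold_pos : ∀ n ω, 0 < hold n ω
  /-- under `μ x` the chain starts at `x` -/
  start : ∀ x : X, μ x {ω | jump 0 ω = x} = 1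
  /-- finite-dimensional law: the embedded chain is Markov with transition
  probabilities `P x y = Γ x y / γ x` (for `y ≠ x`), and conditionally on the
  embedded chain the holding times are independent exponentials of rates
  `γ (jump n)` -/
  law : ∀ (x : X) (n : ℕ) (path : ℕ → X) (t : ℕ → ℝ), path 0 = x → (∀ k, 0 ≤ t k) →
    μ x {ω | (∀ k, k ≤ n → jump k ω = path k) ∧ (∀ k, k < n → t k < hold k ω)}
      = ENNReal.ofReal (∏ k ∈ Finset.range n,
          ((if path (k+1) = path k then 0 else Γ (path k) (path (k+1)) / γ (path k))
            * Real.exp (-(γ (path k)) * t k)))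

namespace CTMC

attribute [instance] CTMC.countX CTMC.infX CTMC.measΩ CTMC.probμ

variable (M : CTMC)

/-- embedded chain transition probabilities -/
noncomputable def P (x y : M.X) : ℝ := if y = x then 0 else M.Γ x y / M.γ x

/-- jump times -/
noncomputable def J (n : ℕ) (ω : M.Ω) : ℝ := ∑ k ∈ Finset.range n, M.hold k ω

/-- explosion (life) time -/
noncomputable def zeta (ω : M.Ω) : ℝ≥0∞ := ⨆ n, ENNReal.ofReal (M.J n ω)

/-- the continuous-time chain: `pos t ω = some (jump n ω)` if `J n ≤ t < J (n+1)`,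
and `none` (the cemetery state `∂`) after the explosion time. -/
noncomputable def pos (t : ℝ) (ω : M.Ω) : Option M.X :=
  if h : ∃ n, M.J n ω ≤ t ∧ t < M.J (n+1) ω then some (M.jump h.choose ω) else none

/-- passage time: `τ_A = inf {t ≥ 0 : ξ_t ∈ A}` -/
noncomputable def tau (A : Set M.X) (ω : M.Ω) : ℝ≥0∞ :=
  sInf (ENNReal.ofReal '' {s : ℝ | 0 ≤ s ∧ ∃ a ∈ A, M.pos s ω = some a})

/-- `f` belongs to the domain of the generator -/
def InDom (f : M.X → ℝ) : Prop :=
  ∀ x : M.X, Summable (fun y => if y = x then 0 else M.Γ x y * f y)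

/-- `f ∈ Dom_+(Γ)` -/
def InDomPos (f : M.X → ℝ) : Prop := (∀ x, 0 ≤ f x) ∧ M.InDom f

/-- action of the generator : `Γ f (x) = ∑_y Γ_{xy} f(y)` -/
noncomputable def gen (f : M.X → ℝ) (x : M.X) : ℝ :=
  (∑' y, if y = x then 0 else M.Γ x y * f y) - M.γ x * f x

/-- recurrence of the embedded jump chain -/
def JumpRecurrent : Prop := ∀ x : M.X, M.μ x {ω | ∃ n, 1 ≤ n ∧ M.jump n ω = x} = 1

/-- `f → ∞` : all sublevel sets are finite -/
def FinSublevels (f : M.X → ℝ) : Prop := ∀ r : ℝ, {x : M.X | f x ≤ r}.Finite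

end CTMC

namespace CTMC

open ProbabilityTheory

/-- tail of the exponential distribution -/
lemma expMeasure_Ioi {r : ℝ} (hr : 0 < r) (t : ℝ) :
    expMeasure r (Ioi t) = ENNReal.ofReal (Real.exp (-r * max t 0)) := by
  have := isProbabilityMeasure_expMeasure hr
  rw [← compl_Iic, prob_compl_eq_one_sub measurableSet_Iic, ← ofReal_cdf, cdf_expMeasure_eq hr,
    ← ENNReal.ofReal_one, ← ENNReal.ofReal_sub]
  · congr 1
    split_ifs with h
    · rw [max_eq_left h]; simp
    · rw [max_eq_right (not_le.1 h).le]; simp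
  · split_ifs with h
    · simp only [sub_nonneg, Real.exp_le_one_iff, Left.neg_nonpos_iff]
      exact mul_nonneg hr.le h
    · exact le_rfl

/-- the embedded chain follows `path` up to step `n` -/
def Ev (M : CTMC) (path : ℕ → M.X) (n : ℕ) : Set M.Ω := {ω | ∀ k, k ≤ n → M.jump k ω = path k}

lemma measurableSet_Ev (M : CTMC) (path : ℕ → M.X) (n : ℕ) : MeasurableSet (M.Ev path n) := by
  have : M.Ev path n = ⋂ k, ⋂ (_ : k ≤ n), {ω | M.jump k ω = path k} := by
    ext ω; simp [Ev]
  rw [this]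
  exact MeasurableSet.iInter fun k => MeasurableSet.iInter fun _ => M.jump_meas k _

lemma P_nonneg (M : CTMC) (x y : M.X) : 0 ≤ M.P x y := by
  unfold P
  split_ifs with h
  · exact le_rfl
  · exact div_nonneg (M.Γ_offdiag_nonneg x y h) (M.γ_pos x).le

instance instFiniteExp (M : CTMC) (y : M.X) : IsProbabilityMeasure (expMeasure (M.γ y)) :=
  isProbabilityMeasure_expMeasure (M.γ_pos y)

/-- the one step measure -/
noncomputable def stepM (M : CTMC) (y z : M.X) : Measure ℝ :=
  ENNReal.ofReal (M.P y z) • expMeasure (M.γ y)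

instance instFiniteStep (M : CTMC) (y z : M.X) : IsFiniteMeasure (M.stepM y z) :=
  Measure.smul_finite _ ENNReal.ofReal_ne_top

/-- the holding times as a random vector -/
def holdV (M : CTMC) (n : ℕ) (ω : M.Ω) : Fin n → ℝ := fun k => M.hold k ω

lemma measurable_holdV (M : CTMC) (n : ℕ) : Measurable (M.holdV n) :=
  measurable_pi_lambda _ fun k => M.hold_meas k

lemma map_holdV (M : CTMC) (x : M.X) (path : ℕ → M.X) (h0 : path 0 = x) (n : ℕ) :
    Measure.map (M.holdV n) ((M.μ x).restrict (M.Ev path n)) =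
      Measure.pi (fun k : Fin n => M.stepM (path k) (path (k + 1))) := by
  symm
  refine Measure.pi_eq_generateFrom (C := fun _ => range Ioi)
    (fun _ => ((borel_eq_generateFrom_Ioi ℝ).symm.trans (BorelSpace.measurable_eq (α := ℝ)).symm))
    (fun _ => isPiSystem_Ioi) (fun i => ?_) ?_
  · exact {
      set := fun m => Ioi (-(m : ℝ))
      set_mem := fun m => ⟨_, rfl⟩
      finite := fun m => measure_lt_top _ _
      spanning := by
        ext y
        simp only [mem_iUnion, mem_Ioi, mem_univ, iff_true]
        obtain ⟨m, hm⟩ := exists_nat_gt (-y)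
        exact ⟨m, by linarith⟩ }
  · intro s hs
    choose t ht using hs
    obtain rfl : (fun i => Ioi (t i)) = s := funext ht
    have hms : MeasurableSet (Set.pi univ fun i : Fin n => Ioi (t i)) :=
      MeasurableSet.univ_pi fun i => measurableSet_Ioi
    rw [Measure.map_apply (M.measurable_holdV n) hms,
      Measure.restrict_apply (M.measurable_holdV n hms)]
    set T : ℕ → ℝ := fun k => if h : k < n then max (t ⟨k, h⟩) 0 else 0 with hT
    have hl := M.law x n path T h0 (by
      intro k; simp only [hT]; split_ifs
      · exact le_max_right _ _
      · exact le_rfl)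
    have hset : (M.holdV n) ⁻¹' (Set.pi univ fun i : Fin n => Ioi (t i)) ∩ M.Ev path n =
        {ω | (∀ k, k ≤ n → M.jump k ω = path k) ∧ (∀ k, k < n → T k < M.hold k ω)} := by
      ext ω
      simp only [mem_inter_iff, mem_preimage, Set.mem_pi, mem_univ, true_imp_iff, mem_Ioi, holdV,
        Ev, mem_ofPred_eq]
      rw [and_comm]
      refine and_congr_right fun _ => ?_
      constructor
      · intro h k hk
        simp only [hT, hk, dif_pos]
        exact max_lt (h ⟨k, hk⟩) (M.hold_pos k ω)
      · intro h i
        have := h i i.2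
        simp only [hT, i.2, dif_pos] at this
        exact (le_max_left _ _).trans_lt this
    rw [hset, hl, ← Fin.prod_univ_eq_prod_range (fun k =>
          ((if path (k+1) = path k then 0 else M.Γ (path k) (path (k+1)) / M.γ (path k))
            * Real.exp (-(M.γ (path k)) * T k))) n, ENNReal.ofReal_prod_of_nonneg]
    · refine Finset.prod_congr rfl fun i _ => ?_
      rw [ENNReal.ofReal_mul (by exact M.P_nonneg _ _)]
      simp only [stepM, Measure.smul_apply, smul_eq_mul, expMeasure_Ioi (M.γ_pos _), hT, i.2,
        dif_pos]
      rfl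
    · intro i _
      exact mul_nonneg (M.P_nonneg _ _) (Real.exp_pos _).le

lemma measurable_J (M : CTMC) (n : ℕ) : Measurable (M.J n) :=
  Finset.measurable_fun_sum _ fun k _ => M.hold_meas k

/-- Markov property, path by path. -/
lemma markov (M : CTMC) (x : M.X) (path : ℕ → M.X) (h0 : path 0 = x) (n : ℕ)
    (g : ℝ → ℝ≥0∞) (hg : Measurable g) :
    ∫⁻ ω in M.Ev path (n + 1), g (M.J (n + 1) ω) ∂(M.μ x) =
      ENNReal.ofReal (M.P (path n) (path (n + 1))) *
        ∫⁻ ω in M.Ev path n, ∫⁻ u, g (M.J n ω + u) ∂(expMeasure (M.γ (path n))) ∂(M.μ x) := by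
  have hsum : ∀ m, Measurable fun v : Fin m → ℝ => ∑ i, v i := fun m =>
    Finset.measurable_fun_sum _ fun k _ => measurable_pi_apply k
  have hg2 : Measurable fun s : ℝ => ∫⁻ u, g (s + u) ∂(expMeasure (M.γ (path n))) := by
    apply Measurable.lintegral_prod_right' (f := fun z : ℝ × ℝ => g (z.1 + z.2))
    exact hg.comp (measurable_fst.add measurable_snd)
  have hJ : ∀ m ω, M.J m ω = ∑ i, M.holdV m ω i := fun m ω => by
    simp only [J, holdV]; exact (Fin.sum_univ_eq_sum_range (fun k => M.hold k ω) m).symm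
  have hgs : ∀ m, Measurable fun v : Fin m → ℝ => g (∑ i, v i) := fun m => hg.comp (hsum m)
  have hgs2 : Measurable fun v : Fin n → ℝ =>
      ∫⁻ u, g (∑ i, v i + u) ∂(expMeasure (M.γ (path n))) := hg2.comp (hsum n)
  have hgp : Measurable fun z : ℝ × (Fin n → ℝ) => g (∑ i, z.2 i + z.1) :=
    hg.comp (((hsum n).comp measurable_snd).add measurable_fst)
  have e1 : ∫⁻ ω in M.Ev path (n + 1), g (M.J (n + 1) ω) ∂(M.μ x) =
      ∫⁻ v : Fin (n + 1) → ℝ, g (∑ i, v i)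
        ∂(Measure.pi (fun k : Fin (n + 1) => M.stepM (path k) (path (k + 1)))) := by
    rw [← M.map_holdV x path h0, lintegral_map (hgs _) (M.measurable_holdV _)]
    simp only [hJ]
  have e2 : ∫⁻ ω in M.Ev path n, ∫⁻ u, g (M.J n ω + u) ∂(expMeasure (M.γ (path n))) ∂(M.μ x) =
      ∫⁻ v : Fin n → ℝ, ∫⁻ u, g (∑ i, v i + u) ∂(expMeasure (M.γ (path n)))
        ∂(Measure.pi (fun k : Fin n => M.stepM (path k) (path (k + 1)))) := by
    rw [← M.map_holdV x path h0, lintegral_map hgs2 (M.measurable_holdV _)]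
    simp only [hJ]
  have hmp := measurePreserving_piFinSuccAbove
    (fun k : Fin (n + 1) => M.stepM (path k) (path (k + 1))) (Fin.last n)
  have e3 : ∫⁻ v : Fin (n + 1) → ℝ, g (∑ i, v i)
        ∂(Measure.pi (fun k : Fin (n + 1) => M.stepM (path k) (path (k + 1)))) =
      ∫⁻ z : ℝ × (Fin n → ℝ), g (∑ i, z.2 i + z.1)
        ∂((M.stepM (path n) (path (n + 1))).prod
          (Measure.pi (fun k : Fin n => M.stepM (path k) (path (k + 1))))) := by
    have := hmp.lintegral_comp (f := fun z : ℝ × (Fin n → ℝ) => g (∑ i, z.2 i + z.1))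
      hgp
    simp only [Fin.succAbove_last, Fin.val_last, Fin.val_castSucc] at this
    rw [← this]
    refine lintegral_congr fun v => ?_
    rw [Fin.sum_univ_castSucc]
    congr 2
    refine Finset.sum_congr rfl fun i _ => ?_
    simp [MeasurableEquiv.piFinSuccAbove, Fin.insertNthEquiv, Fin.init]
  rw [e1, e2, e3, lintegral_prod_symm' _ hgp]
  rw [← lintegral_const_mul _ hgs2]
  refine lintegral_congr fun v => ?_
  simp only [stepM, lintegral_smul_measure, smul_eq_mul]

end CTMC

namespace CTMC

open ProbabilityTheory

lemma measurable_comp_jump (M : CTMC) (n : ℕ) (V : M.X → ℝ → ℝ≥0∞) (hV : ∀ y, Measurable (V y)) :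
    Measurable fun ω => V (M.jump n ω) (M.J n ω) := by
  intro s hs
  have : (fun ω => V (M.jump n ω) (M.J n ω)) ⁻¹' s =
      ⋃ y, ({ω | M.jump n ω = y} ∩ (fun ω => V y (M.J n ω)) ⁻¹' s) := by
    ext ω
    simp
  rw [this]
  exact MeasurableSet.iUnion fun y => (M.jump_meas n y).inter
    (((hV y).comp (M.measurable_J n)) hs)

lemma J_nonneg (M : CTMC) (n : ℕ) (ω : M.Ω) : 0 ≤ M.J n ω :=
  Finset.sum_nonneg fun k _ => (M.hold_pos k ω).le

lemma measurableSet_jump (M : CTMC) (n : ℕ) (A : Set M.X) :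
    MeasurableSet {ω | M.jump n ω ∈ A} := by
  have : {ω | M.jump n ω ∈ A} = ⋃ y ∈ A, {ω | M.jump n ω = y} := by ext ω; simp
  rw [this]
  exact MeasurableSet.biUnion (to_countable A) fun y _ => M.jump_meas n y

/-- not yet in `A` up to step `n` -/
def alive (M : CTMC) (A : Set M.X) (n : ℕ) : Set M.Ω := {ω | ∀ k, k ≤ n → M.jump k ω ∉ A}

lemma measurableSet_alive (M : CTMC) (A : Set M.X) (n : ℕ) : MeasurableSet (M.alive A n) := by
  have : M.alive A n = ⋂ k, ⋂ (_ : k ≤ n), {ω | M.jump k ω ∈ A}ᶜ := by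
    ext ω; simp [alive]
  rw [this]
  exact MeasurableSet.iInter fun k => MeasurableSet.iInter fun _ => (M.measurableSet_jump k A).compl

/-- cylinder sets -/
def Cyl (M : CTMC) {n : ℕ} (σ : Fin (n + 1) → M.X) : Set M.Ω :=
  {ω | ∀ i : Fin (n + 1), M.jump i ω = σ i}

/-- extension of a finite path -/
noncomputable def extP (M : CTMC) {n : ℕ} (σ : Fin (n + 1) → M.X) (z : M.X) : ℕ → M.X :=
  fun k => if h : k < n + 1 then σ ⟨k, h⟩ else z

lemma Ev_extP (M : CTMC) {n : ℕ} (σ : Fin (n + 1) → M.X) (z : M.X) :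
    M.Ev (M.extP σ z) n = M.Cyl σ := by
  ext ω
  simp only [Ev, Cyl, mem_ofPred_eq, extP]
  constructor
  · intro h i
    have := h i (Nat.lt_succ_iff.1 i.2)
    rwa [dif_pos i.2] at this
  · intro h k hk
    rw [dif_pos (Nat.lt_succ_iff.2 hk)]
    exact h ⟨k, Nat.lt_succ_iff.2 hk⟩

lemma Ev_extP_succ (M : CTMC) {n : ℕ} (σ : Fin (n + 1) → M.X) (z : M.X) :
    M.Ev (M.extP σ z) (n + 1) = M.Cyl σ ∩ {ω | M.jump (n + 1) ω = z} := by
  rw [← M.Ev_extP σ z]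
  ext ω
  simp only [Ev, mem_ofPred_eq, mem_inter_iff]
  constructor
  · intro h
    refine ⟨fun k hk => h k (by omega), ?_⟩
    have := h (n + 1) le_rfl
    simpa [extP] using this
  · rintro ⟨h1, h2⟩ k hk
    rcases Nat.lt_or_ge k (n + 1) with h | h
    · exact h1 k (by omega)
    · obtain rfl : k = n + 1 := by omega
      simpa [extP] using h2

lemma measurableSet_Cyl (M : CTMC) {n : ℕ} (σ : Fin (n + 1) → M.X) : MeasurableSet (M.Cyl σ) := by
  rw [← M.Ev_extP σ (σ 0)]
  exact M.measurableSet_Ev _ _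

lemma lintegral_alive (M : CTMC) (A : Set M.X) (n : ℕ) (x : M.X) (F : M.Ω → ℝ≥0∞) :
    ∫⁻ ω in M.alive A n, F ω ∂(M.μ x) =
      ∑' σ : {σ : Fin (n + 1) → M.X // ∀ i, σ i ∉ A}, ∫⁻ ω in M.Cyl σ.1, F ω ∂(M.μ x) := by
  rw [← lintegral_iUnion (fun σ : {σ : Fin (n + 1) → M.X // ∀ i, σ i ∉ A} =>
    M.measurableSet_Cyl σ.1)]
  · congr 2
    ext ω
    simp only [alive, Cyl, mem_ofPred_eq, mem_iUnion]
    constructor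
    · intro h
      exact ⟨⟨fun i => M.jump i ω, fun i => h i (Nat.lt_succ_iff.1 i.2)⟩, fun i => rfl⟩
    · rintro ⟨σ, h⟩ k hk
      have := h ⟨k, Nat.lt_succ_iff.2 hk⟩
      simp only at this
      rw [this]
      exact σ.2 _
  · intro σ τ hne
    rw [Function.onFun, Set.disjoint_left]
    intro ω h1 h2
    exact hne (Subtype.ext (funext fun i => (h1 i).symm.trans (h2 i)))

lemma step (M : CTMC) (A : Set M.X) (n : ℕ) (x : M.X) (V D : M.X → ℝ → ℝ≥0∞)
    (hV : ∀ y, Measurable (V y)) (hD : ∀ y, Measurable (D y))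
    (h : ∀ y, y ∉ A → ∀ s, 0 ≤ s →
      ∫⁻ u, ∑' z, ENNReal.ofReal (M.P y z) * V z (s + u) ∂(expMeasure (M.γ y)) + D y s ≤ V y s) :
    ∫⁻ ω in M.alive A n, V (M.jump (n + 1) ω) (M.J (n + 1) ω) ∂(M.μ x) +
      ∫⁻ ω in M.alive A n, D (M.jump n ω) (M.J n ω) ∂(M.μ x) ≤
    ∫⁻ ω in M.alive A n, V (M.jump n ω) (M.J n ω) ∂(M.μ x) := by
  rw [M.lintegral_alive, M.lintegral_alive, M.lintegral_alive, ← ENNReal.tsum_add]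
  refine ENNReal.tsum_le_tsum ?_
  rintro ⟨σ, hσ⟩
  simp only
  by_cases h0 : σ 0 = x
  swap
  · have hz : M.μ x (M.Cyl σ) = 0 := by
      have h1 : M.μ x {ω | M.jump 0 ω = x}ᶜ = 0 := by
        rw [prob_compl_eq_zero_iff (M.jump_meas 0 x)]
        exact M.start x
      refine measure_mono_null ?_ h1
      intro ω hω hx
      have := hω 0
      exact h0 (this.symm.trans hx)
    rw [setLIntegral_measure_zero _ _ hz, setLIntegral_measure_zero _ _ hz]
    simp
  set y := σ (Fin.last n) with hy
  have hmVu : ∀ z, Measurable fun s : ℝ => ∫⁻ u, V z (s + u) ∂(expMeasure (M.γ y)) := by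
    intro z
    apply Measurable.lintegral_prod_right' (f := fun w : ℝ × ℝ => V z (w.1 + w.2))
    exact (hV z).comp (measurable_fst.add measurable_snd)
  have e1 : ∫⁻ ω in M.Cyl σ, V (M.jump (n + 1) ω) (M.J (n + 1) ω) ∂(M.μ x) =
      ∫⁻ ω in M.Cyl σ, ∫⁻ u, ∑' z, ENNReal.ofReal (M.P y z) * V z (M.J n ω + u)
        ∂(expMeasure (M.γ y)) ∂(M.μ x) := by
    have hU : M.Cyl σ = ⋃ z, M.Ev (M.extP σ z) (n + 1) := by
      ext ω; simp [Ev_extP_succ]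
    conv_lhs => rw [hU]
    rw [lintegral_iUnion (fun z => M.measurableSet_Ev _ _)]
    swap
    · intro z w hne
      rw [Function.onFun, Set.disjoint_left]
      intro ω h1 h2
      rw [Ev_extP_succ] at h1 h2
      exact hne (h1.2.symm.trans h2.2)
    have e2 : ∀ z, ∫⁻ ω in M.Ev (M.extP σ z) (n + 1), V (M.jump (n + 1) ω) (M.J (n + 1) ω) ∂(M.μ x)
        = ∫⁻ ω in M.Cyl σ, ENNReal.ofReal (M.P y z) *
            ∫⁻ u, V z (M.J n ω + u) ∂(expMeasure (M.γ y)) ∂(M.μ x) := by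
      intro z
      have hp0 : M.extP σ z 0 = x := by rw [← h0]; simp [extP]
      have hpn : M.extP σ z n = y := by rw [hy]; simp [extP, Fin.last]
      have hpn1 : M.extP σ z (n + 1) = z := by simp [extP]
      have hm := M.markov x (M.extP σ z) hp0 n (V z) (hV z)
      rw [hpn, hpn1, Ev_extP] at hm
      have hmm : Measurable fun ω => ∫⁻ u, V z (M.J n ω + u) ∂(expMeasure (M.γ y)) :=
        (hmVu z).comp (M.measurable_J n)
      rw [lintegral_const_mul _ hmm, ← hm]
      refine setLIntegral_congr_fun (M.measurableSet_Ev _ _) ?_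
      intro ω hω
      rw [Ev_extP_succ] at hω
      have : M.jump (n + 1) ω = z := hω.2
      simp only [this]
    rw [tsum_congr e2, ← lintegral_tsum]
    · refine lintegral_congr fun ω => ?_
      rw [lintegral_tsum]
      · refine tsum_congr fun z => ?_
        rw [lintegral_const_mul]
        exact (hV z).comp (measurable_const_add _)
      · intro z
        exact (((hV z).comp (measurable_const_add _)).const_mul _).aemeasurable
    · intro z
      exact (((hmVu z).comp (M.measurable_J n)).const_mul _).aemeasurable
  rw [e1, ← lintegral_add_right _ (M.measurable_comp_jump n D hD)]
  refine setLIntegral_mono (M.measurable_comp_jump n V hV) ?_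
  intro ω hω
  have : M.jump n ω = y := hω (Fin.last n)
  rw [this]
  exact h y (hσ _) _ (M.J_nonneg n ω)

/-- enters `A` exactly at step `n + 1` -/
def hits (M : CTMC) (A : Set M.X) (n : ℕ) : Set M.Ω := M.alive A n ∩ {ω | M.jump (n + 1) ω ∈ A}

lemma measurableSet_hits (M : CTMC) (A : Set M.X) (n : ℕ) : MeasurableSet (M.hits A n) :=
  (M.measurableSet_alive A n).inter (M.measurableSet_jump _ A)

lemma alive_succ (M : CTMC) (A : Set M.X) (n : ℕ) :
    M.alive A (n + 1) = M.alive A n \ {ω | M.jump (n + 1) ω ∈ A} := by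
  ext ω
  simp only [alive, Set.mem_sdiff, mem_ofPred_eq]
  constructor
  · intro h
    exact ⟨fun k hk => h k (by omega), h _ le_rfl⟩
  · rintro ⟨h1, h2⟩ k hk
    rcases Nat.lt_or_ge k (n + 1) with h | h
    · exact h1 k (by omega)
    · obtain rfl : k = n + 1 := by omega
      exact h2

lemma sum_bound (M : CTMC) (A : Set M.X) (x : M.X) (V D : M.X → ℝ → ℝ≥0∞)
    (hV : ∀ y, Measurable (V y)) (hD : ∀ y, Measurable (D y))
    (h : ∀ y, y ∉ A → ∀ s, 0 ≤ s →
      ∫⁻ u, ∑' z, ENNReal.ofReal (M.P y z) * V z (s + u) ∂(expMeasure (M.γ y)) + D y s ≤ V y s)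
    (m : ℕ) :
    ∑ n ∈ Finset.range m,
      (∫⁻ ω in M.hits A n, V (M.jump (n + 1) ω) (M.J (n + 1) ω) ∂(M.μ x) +
      ∫⁻ ω in M.alive A n, D (M.jump n ω) (M.J n ω) ∂(M.μ x)) +
    ∫⁻ ω in M.alive A m, V (M.jump m ω) (M.J m ω) ∂(M.μ x) ≤ V x 0 := by
  induction m with
  | zero =>
    simp only [Finset.range_zero, Finset.sum_empty, zero_add]
    refine (setLIntegral_le_lintegral _ _).trans ?_
    have : ∫⁻ ω, V (M.jump 0 ω) (M.J 0 ω) ∂(M.μ x) = ∫⁻ ω, V x 0 ∂(M.μ x) := by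
      refine lintegral_congr_ae ?_
      have h1 : ∀ᵐ ω ∂(M.μ x), M.jump 0 ω = x := by
        have := (prob_compl_eq_zero_iff (M.jump_meas 0 x)).2 (M.start x)
        exact this
      filter_upwards [h1] with ω hω
      simp [hω, J]
    rw [this]
    simp
  | succ m ih =>
    refine le_trans ?_ ih
    rw [Finset.sum_range_succ, add_assoc]
    gcongr
    refine le_trans (le_of_eq ?_) (M.step A m x V D hV hD h)
    rw [← lintegral_inter_add_sdiff (fun ω => V (M.jump (m + 1) ω) (M.J (m + 1) ω)) (M.alive A m)
      (M.measurableSet_jump (m + 1) A), ← alive_succ]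
    unfold hits
    ring

lemma tau_le (M : CTMC) (A : Set M.X) (m : ℕ) (ω : M.Ω) (h : M.jump m ω ∈ A) :
    M.tau A ω ≤ ENNReal.ofReal (M.J m ω) := by
  refine sInf_le ⟨M.J m ω, ⟨M.J_nonneg m ω, M.jump m ω, h, ?_⟩, rfl⟩
  have hmono : StrictMono fun n => M.J n ω := by
    refine strictMono_nat_of_lt_succ fun n => ?_
    simp only [J, Finset.sum_range_succ]
    linarith [M.hold_pos n ω]
  have hex : ∃ n, M.J n ω ≤ M.J m ω ∧ M.J m ω < M.J (n + 1) ω :=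
    ⟨m, le_rfl, hmono (Nat.lt_succ_self m)⟩
  unfold pos
  rw [dif_pos hex]
  have h1 := hmono.le_iff_le.1 hex.choose_spec.1
  have h2 := hmono.lt_iff_lt.1 hex.choose_spec.2
  have : hex.choose = m := by omega
  rw [this]

end CTMC

namespace CTMC

open ProbabilityTheory

lemma conv_ineq {X Y s r : ℝ} (hX : 0 < X) (hY : 0 ≤ Y) (hs : 0 ≤ s) (hr : 1 ≤ r) :
    (Y + s) ^ r ≤ (X + s) ^ (r - 1) * (s + X ^ (1 - r) * Y ^ r) := by
  have hXs : 0 < X + s := by linarith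
  have hYX : Y / X ∈ Ici (0 : ℝ) := div_nonneg hY hX.le
  have h01 : (1 : ℝ) ∈ Ici (0 : ℝ) := zero_le_one (α := ℝ)
  have ha : 0 ≤ X / (X + s) := by positivity
  have hb : 0 ≤ s / (X + s) := by positivity
  have hc := (convexOn_rpow hr).2 hYX h01 ha hb (by field_simp)
  simp only [smul_eq_mul, mul_one, Real.one_rpow] at hc
  have e1 : Y + s = (X + s) * (X / (X + s) * (Y / X) + s / (X + s)) := by
    field_simp
  have e2 : (X + s) ^ r = (X + s) ^ (r - 1) * (X + s) := by
    rw [← Real.rpow_add_one hXs.ne']; congr 1; ring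
  have e3 : (Y / X) ^ r = Y ^ r * X ^ (1 - r) / X := by
    rw [Real.div_rpow hY hX.le, Real.rpow_sub hX, Real.rpow_one]
    field_simp
  calc (Y + s) ^ r = (X + s) ^ r * (X / (X + s) * (Y / X) + s / (X + s)) ^ r := by
        rw [← Real.mul_rpow hXs.le (by positivity), ← e1]
    _ ≤ (X + s) ^ r * (X / (X + s) * (Y / X) ^ r + s / (X + s)) := by gcongr
    _ = _ := by
        rw [e2, e3]
        field_simp
        ring

lemma ae_exp_pos {γ : ℝ} (hγ : 0 < γ) : ∀ᵐ u ∂(expMeasure γ), u ∈ Ioi (0 : ℝ) := by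
  have := isProbabilityMeasure_expMeasure hγ
  refine (prob_compl_eq_zero_iff measurableSet_Ioi).2 ?_
  rw [expMeasure_Ioi hγ]
  simp

lemma exp_int {b ε γ r : ℝ} (hb : 0 < b) (hε : 0 < ε) (hγ : 0 < γ) (hr : 1 ≤ r)
    (hpos : ∀ u, 0 < u → 0 ≤ (b + ε * u) ^ (r - 1) * (b + ε * u - r * ε / γ)) :
    ∫⁻ u, ENNReal.ofReal ((b + ε * u) ^ (r - 1) * (b + ε * u - r * ε / γ)) ∂(expMeasure γ) ≤
      ENNReal.ofReal (b ^ r) := by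
  have hmeas : Measurable fun u : ℝ =>
      ENNReal.ofReal ((b + ε * u) ^ (r - 1) * (b + ε * u - r * ε / γ)) := by fun_prop
  rw [← Measure.restrict_eq_self_of_ae_mem (ae_exp_pos hγ)]
  have hexp : expMeasure γ = volume.withDensity (exponentialPDF γ) := rfl
  have hpdf : Measurable (exponentialPDF γ) :=
    (measurable_exponentialPDFReal γ).ennreal_ofReal
  rw [hexp, restrict_withDensity measurableSet_Ioi,
    lintegral_withDensity_eq_lintegral_mul _ hpdf hmeas]
  set G : ℝ → ℝ := fun u => (b + ε * u) ^ r * Real.exp (-γ * u) with hG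
  set G' : ℝ → ℝ := fun u =>
    -(γ * Real.exp (-(γ * u)) * ((b + ε * u) ^ (r - 1) * (b + ε * u - r * ε / γ))) with hG'
  have hder : ∀ u ∈ Ici (0 : ℝ), HasDerivAt G (G' u) u := by
    intro u hu
    have hu' : 0 < b + ε * u := by
      have : (0 : ℝ) ≤ u := hu
      positivity
    have h1 : HasDerivAt (fun u => b + ε * u) ε u := by
      simpa using ((hasDerivAt_id u).const_mul ε).const_add b
    have h2 := h1.rpow_const (p := r) (Or.inl hu'.ne')
    have h3 : HasDerivAt (fun u => Real.exp (-γ * u)) (Real.exp (-γ * u) * (-γ)) u := by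
      simpa using ((hasDerivAt_id u).const_mul (-γ)).exp
    have h4 : HasDerivAt G _ u := h2.mul h3
    refine h4.congr_deriv ?_
    simp only [hG']
    have : (b + ε * u) ^ r = (b + ε * u) ^ (r - 1) * (b + ε * u) := by
      rw [← Real.rpow_add_one hu'.ne']; congr 1; ring
    rw [this, neg_mul]
    field_simp
    ring
  have hneg : ∀ u ∈ Ioi (0 : ℝ), G' u ≤ 0 := by
    intro u hu
    simp only [hG', Left.neg_nonpos_iff]
    exact mul_nonneg (by positivity) (hpos u hu)
  have hlim : Tendsto G atTop (nhds 0) := by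
    have hl : Tendsto (fun u : ℝ => b + ε * u) atTop atTop :=
      tendsto_atTop_add_const_left _ _ (tendsto_id.const_mul_atTop hε)
    have h1 := (tendsto_rpow_mul_exp_neg_mul_atTop_nhds_zero r (γ / ε) (by positivity)).comp hl
    have h2 := h1.const_mul (Real.exp (γ / ε * b))
    rw [mul_zero] at h2
    refine h2.congr fun u => ?_
    simp only [hG, Function.comp]
    rw [mul_left_comm, ← Real.exp_add]
    congr 2
    field_simp
    ring
  have hInt1 := integrableOn_Ioi_deriv_of_nonpos' hder hneg hlim
  have hval := integral_Ioi_of_hasDerivAt_of_nonpos' hder hneg hlim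
  have e1 : ∫⁻ u in Ioi (0 : ℝ), (exponentialPDF γ * fun u : ℝ =>
      ENNReal.ofReal ((b + ε * u) ^ (r - 1) * (b + ε * u - r * ε / γ))) u =
      ∫⁻ u in Ioi (0 : ℝ), ENNReal.ofReal (-G' u) := by
    refine setLIntegral_congr_fun measurableSet_Ioi ?_
    intro u hu
    simp only [Pi.mul_apply, hG', neg_neg]
    rw [exponentialPDF_of_nonneg (le_of_lt hu), ← ENNReal.ofReal_mul (by positivity)]
  have hInt2 : Integrable (fun u => -G' u) (volume.restrict (Ioi 0)) := hInt1.neg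
  rw [e1, ← ofReal_integral_eq_lintegral_ofReal hInt2]
  · apply ENNReal.ofReal_le_ofReal
    rw [integral_neg, hval]
    simp [hG]
  · filter_upwards [ae_restrict_mem measurableSet_Ioi] with u hu
    simpa using hneg u hu

end CTMC

namespace CTMC

open ProbabilityTheory

lemma hasSum_congr_aux {ι : Type} {u v : ι → ℝ} {S : ℝ} (h : HasSum u S) (huv : ∀ z, v z = u z) :
    HasSum v S := by
  obtain rfl : v = u := funext huv
  exact h

lemma hasSum_P (M : CTMC) (y : M.X) : HasSum (M.P y) 1 := by
  have h := (M.γ_sum y).div_const (M.γ y)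
  rw [div_self (M.γ_pos y).ne'] at h
  refine hasSum_congr_aux h fun z => ?_
  unfold P
  split_ifs <;> simp

lemma drift_sum (M : CTMC) (g : M.X → ℝ) (hg : M.InDom g) (y : M.X) (d : ℝ)
    (hd : M.gen g y ≤ -d) :
    ∃ S, HasSum (fun z => M.P y z * g z) S ∧ S ≤ g y - d / M.γ y := by
  refine ⟨(∑' z, if z = y then 0 else M.Γ y z * g z) / M.γ y, ?_, ?_⟩
  · refine hasSum_congr_aux ((hg y).hasSum.div_const (M.γ y)) fun z => ?_
    unfold P
    split_ifs
    · simp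
    · ring
  · have hγ := M.γ_pos y
    unfold gen at hd
    rw [div_le_iff₀ hγ, sub_mul, div_mul_cancel₀ _ hγ.ne']
    linarith

lemma tsum_ofReal_le (M : CTMC) (g : M.X → ℝ) (hg : ∀ z, 0 ≤ g z) (y : M.X) (S : ℝ)
    (hS : HasSum (fun z => M.P y z * g z) S) :
    ∑' z, ENNReal.ofReal (M.P y z) * ENNReal.ofReal (g z) = ENNReal.ofReal S := by
  rw [← hS.tsum_eq, ENNReal.ofReal_tsum_of_nonneg
    (fun z => mul_nonneg (M.P_nonneg y z) (hg z)) hS.summable]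
  exact tsum_congr fun z => (ENNReal.ofReal_mul (M.P_nonneg y z)).symm

lemma sq_rpow_half {v : ℝ} (hv : 0 ≤ v) (p : ℝ) : (v ^ 2) ^ (p / 2) = v ^ p := by
  rw [← Real.rpow_natCast, ← Real.rpow_mul hv]
  congr 1
  push_cast
  ring

lemma V1_drift (M : CTMC) (f : M.X → ℝ) (p c : ℝ) (hf : ∀ x, 0 ≤ f x) (hc : 0 < c)
    (hfp : M.InDom fun x => f x ^ p) (y : M.X)
    (hd : M.gen (fun y => f y ^ p) y ≤ -(c * f y ^ (p - 2))) :
    ∫⁻ _, ∑' z, ENNReal.ofReal (M.P y z) * ENNReal.ofReal (f z ^ p) ∂(expMeasure (M.γ y)) +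
      ENNReal.ofReal (c * f y ^ (p - 2) / M.γ y) ≤ ENNReal.ofReal (f y ^ p) := by
  obtain ⟨S, hS, hSle⟩ := M.drift_sum _ hfp y _ hd
  have hnn : ∀ z, 0 ≤ f z ^ p := fun z => Real.rpow_nonneg (hf z) _
  rw [M.tsum_ofReal_le (fun z => f z ^ p) hnn y S hS]
  simp only [lintegral_const, measure_univ, mul_one]
  rw [← ENNReal.ofReal_add]
  · exact ENNReal.ofReal_le_ofReal (by linarith)
  · exact hS.nonneg fun z => mul_nonneg (M.P_nonneg y z) (hnn z)
  · exact div_nonneg (mul_nonneg hc.le (Real.rpow_nonneg (hf y) _)) (M.γ_pos y).le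

lemma V2_drift (M : CTMC) (f : M.X → ℝ) (p c : ℝ) (hp : 2 ≤ p) (hf : ∀ x, 0 ≤ f x) (hc : 0 < c)
    (hfp : M.InDom fun x => f x ^ p) (y : M.X) (hy : 0 < f y)
    (hd : M.gen (fun y => f y ^ p) y ≤ -(c * f y ^ (p - 2))) (ε : ℝ) (hε : p / 2 * ε = c)
    (s : ℝ) (hs : 0 ≤ s) :
    ∫⁻ u, ∑' z, ENNReal.ofReal (M.P y z) * ENNReal.ofReal ((f z ^ 2 + ε * (s + u)) ^ (p / 2))
      ∂(expMeasure (M.γ y)) ≤ ENNReal.ofReal ((f y ^ 2 + ε * s) ^ (p / 2)) := by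
  obtain ⟨S, hS, hSle⟩ := M.drift_sum _ hfp y _ hd
  have hε0 : 0 < ε := by
    by_contra h
    have : p / 2 * ε ≤ 0 := mul_nonpos_of_nonneg_of_nonpos (by linarith) (not_lt.1 h)
    linarith
  have hγ := M.γ_pos y
  have hX : 0 < f y ^ 2 := by positivity
  have key : ∀ t, 0 ≤ t →
      ∑' z, ENNReal.ofReal (M.P y z) * ENNReal.ofReal ((f z ^ 2 + t) ^ (p / 2)) ≤
        ENNReal.ofReal ((f y ^ 2 + t) ^ (p / 2 - 1) * (t + (f y ^ 2) ^ (1 - p / 2) * S)) ∧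
      0 ≤ (f y ^ 2 + t) ^ (p / 2 - 1) * (t + (f y ^ 2) ^ (1 - p / 2) * S) ∧
      (f y ^ 2 + t) ^ (p / 2 - 1) * (t + (f y ^ 2) ^ (1 - p / 2) * S) ≤
        (f y ^ 2 + t) ^ (p / 2 - 1) * (f y ^ 2 + t - p / 2 * ε / M.γ y) := by
    intro t ht
    have hnn : ∀ z, 0 ≤ f z ^ p := fun z => Real.rpow_nonneg (hf z) _
    have hS0 : 0 ≤ S := hS.nonneg fun z => mul_nonneg (M.P_nonneg y z) (hnn z)
    have hsum : HasSum (fun z => M.P y z *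
        ((f y ^ 2 + t) ^ (p / 2 - 1) * (t + (f y ^ 2) ^ (1 - p / 2) * f z ^ p)))
        ((f y ^ 2 + t) ^ (p / 2 - 1) * (t + (f y ^ 2) ^ (1 - p / 2) * S)) := by
      have := (((M.hasSum_P y).mul_left t).add (hS.mul_left ((f y ^ 2) ^ (1 - p / 2)))).mul_left
        ((f y ^ 2 + t) ^ (p / 2 - 1))
      rw [mul_one] at this
      exact hasSum_congr_aux this fun z => by ring
    refine ⟨?_, by positivity, ?_⟩
    · rw [← M.tsum_ofReal_le _ ?_ y _ hsum]
      · refine ENNReal.tsum_le_tsum fun z => ?_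
        gcongr
        have := conv_ineq hX (sq_nonneg (f z)) ht (r := p / 2) (by linarith)
        rwa [sq_rpow_half (hf z)] at this
      · intro z
        have := hnn z
        positivity
    · have e1 : (f y ^ 2) ^ (1 - p / 2) * (f y ^ p - c * f y ^ (p - 2) / M.γ y) =
          f y ^ 2 - c / M.γ y := by
        have e2 : (f y ^ 2) ^ (1 - p / 2) * f y ^ (p - 2) = 1 := by
          rw [← sq_rpow_half hy.le (p - 2), ← Real.rpow_add hX]
          rw [show 1 - p / 2 + (p - 2) / 2 = 0 by ring, Real.rpow_zero]
        have e3 : f y ^ p = f y ^ (p - 2) * f y ^ 2 := by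
          rw [← Real.rpow_add_natCast hy.ne']
          congr 1
          push_cast
          ring
        rw [e3]
        linear_combination (f y ^ 2 - c / M.γ y) * e2
      have h2 : (f y ^ 2) ^ (1 - p / 2) * S ≤ f y ^ 2 - c / M.γ y := by
        rw [← e1]
        gcongr
      rw [hε]
      gcongr
      linarith
  have hb : 0 < f y ^ 2 + ε * s := by positivity
  have hpos : ∀ u, 0 < u → 0 ≤ (f y ^ 2 + ε * s + ε * u) ^ (p / 2 - 1) *
      (f y ^ 2 + ε * s + ε * u - p / 2 * ε / M.γ y) := by
    intro u hu
    have h := key (ε * (s + u)) (by positivity)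
    rw [show f y ^ 2 + ε * s + ε * u = f y ^ 2 + ε * (s + u) by ring]
    exact h.2.1.trans h.2.2
  refine le_trans (lintegral_mono_ae ?_) (exp_int hb hε0 hγ (r := p / 2) (by linarith) hpos)
  filter_upwards [ae_exp_pos hγ] with u hu
  have hu' : 0 < u := hu
  have h := key (ε * (s + u)) (by positivity)
  rw [show f y ^ 2 + ε * s + ε * u = f y ^ 2 + ε * (s + u) by ring]
  exact h.1.trans (ENNReal.ofReal_le_ofReal h.2.2)

lemma young {L q r : ℝ} (hL : 0 < L) (hq : 0 < q) (hqr : q ≤ r) (t : ℝ≥0∞) :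
    t ^ q ≤ ENNReal.ofReal (L ^ q) + ENNReal.ofReal (L ^ (q - r)) * t ^ r := by
  have hr : 0 < r := hq.trans_le hqr
  by_cases ht : t = ⊤
  · subst ht
    rw [ENNReal.top_rpow_of_pos hr, ENNReal.mul_top]
    · simp
    · simpa using Real.rpow_pos_of_pos hL _
  · obtain ⟨v, hv, rfl⟩ : ∃ v, 0 ≤ v ∧ t = ENNReal.ofReal v :=
      ⟨t.toReal, ENNReal.toReal_nonneg, (ENNReal.ofReal_toReal ht).symm⟩
    rw [ENNReal.ofReal_rpow_of_nonneg hv hq.le, ENNReal.ofReal_rpow_of_nonneg hv hr.le,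
      ← ENNReal.ofReal_mul (by positivity), ← ENNReal.ofReal_add (by positivity) (by positivity)]
    apply ENNReal.ofReal_le_ofReal
    rcases le_total v L with h | h
    · have h1 : v ^ q ≤ L ^ q := Real.rpow_le_rpow hv h hq.le
      have h2 : 0 ≤ L ^ (q - r) * v ^ r := by positivity
      linarith
    · have hv' : 0 < v := hL.trans_le h
      have h1 : v ^ q = v ^ (q - r) * v ^ r := by
        rw [← Real.rpow_add hv']; congr 1; ring
      have h2 : v ^ (q - r) ≤ L ^ (q - r) :=
        Real.rpow_le_rpow_of_nonpos hL h (by linarith)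
      have h3 : 0 ≤ L ^ q := by positivity
      rw [h1]
      nlinarith [Real.rpow_nonneg hv r]

lemma ae_hits (M : CTMC) (f : M.X → ℝ) (hf : ∀ x, 0 ≤ f x) (hfinf : M.FinSublevels f)
    (p a : ℝ) (hp : 2 ≤ p) (ha : 0 < a)
    (hfp : M.InDom fun x => f x ^ p) (c : ℝ) (hc : 0 < c)
    (hdrift : ∀ x : M.X, a < f x → M.gen (fun y => f y ^ p) x ≤ -(c * f x ^ (p - 2)))
    (x : M.X) (hx : a < f x) :
    ∀ᵐ ω ∂(M.μ x), ∃ n, ω ∈ M.hits {y | f y ≤ a} n := by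
  set A : Set M.X := {y | f y ≤ a} with hA
  set V : M.X → ℝ → ℝ≥0∞ := fun y _ => ENNReal.ofReal (f y ^ p) with hV
  set D : M.X → ℝ → ℝ≥0∞ := fun y _ => ENNReal.ofReal (c * f y ^ (p - 2) / M.γ y) with hD
  have hb := M.sum_bound A x V D (fun y => measurable_const) (fun y => measurable_const)
    (fun y hy s _ => M.V1_drift f p c hf hc hfp y (hdrift y (not_le.1 hy)))
  have hVm : ∀ n, Measurable ((M.alive A n).indicator fun ω => V (M.jump n ω) (M.J n ω)) :=
    fun n => (M.measurable_comp_jump n V fun y => measurable_const).indicator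
      (M.measurableSet_alive A n)
  have hDm : ∀ n, Measurable ((M.alive A n).indicator fun ω => D (M.jump n ω) (M.J n ω)) :=
    fun n => (M.measurable_comp_jump n D fun y => measurable_const).indicator
      (M.measurableSet_alive A n)
  have h1 : ∫⁻ ω, ∑' n, (M.alive A n).indicator (fun ω => D (M.jump n ω) (M.J n ω)) ω ∂(M.μ x)
      ≤ V x 0 := by
    rw [lintegral_tsum fun n => (hDm n).aemeasurable]
    refine ENNReal.tsum_le_of_sum_range_le fun m => ?_
    refine le_trans ?_ (hb m)
    refine le_trans (Finset.sum_le_sum fun n _ => ?_) le_self_add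
    rw [lintegral_indicator (M.measurableSet_alive A n)]
    exact le_add_self
  have h2 : ∫⁻ ω, liminf (fun n => (M.alive A n).indicator
      (fun ω => V (M.jump n ω) (M.J n ω)) ω) atTop ∂(M.μ x) ≤ V x 0 := by
    refine (lintegral_liminf_le hVm).trans ?_
    refine liminf_le_of_le (by isBoundedDefault) fun b hb' => ?_
    obtain ⟨m, hm⟩ := hb'.exists
    refine hm.trans (le_trans ?_ (hb m))
    rw [lintegral_indicator (M.measurableSet_alive A m)]
    exact le_add_self
  have hfin : V x 0 < ⊤ := ENNReal.ofReal_lt_top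
  have h3 := ae_lt_top (Measurable.ennreal_tsum hDm) (h1.trans_lt hfin).ne
  have h4 := ae_lt_top (Measurable.liminf hVm) (h2.trans_lt hfin).ne
  have h5 : ∀ᵐ ω ∂(M.μ x), M.jump 0 ω = x :=
    (prob_compl_eq_zero_iff (M.jump_meas 0 x)).2 (M.start x)
  filter_upwards [h3, h4, h5] with ω hω3 hω4 hω5
  by_contra hno
  push Not at hno
  have hal : ∀ n, ω ∈ M.alive A n := by
    intro n
    induction n with
    | zero =>
      intro k hk
      obtain rfl : k = 0 := by omega
      rw [hω5]
      exact not_le.2 hx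
    | succ n ih =>
      rw [alive_succ]
      exact ⟨ih, fun h => hno n ⟨ih, h⟩⟩
  have hi : ∀ (n : ℕ) (F : M.Ω → ℝ≥0∞), (M.alive A n).indicator F ω = F ω :=
    fun n F => indicator_of_mem (hal n) F
  simp only [hi] at hω3 hω4
  have hD0 : Tendsto (fun n => D (M.jump n ω) (M.J n ω)) atTop (nhds 0) :=
    ENNReal.tendsto_atTop_zero_of_tsum_ne_top hω3.ne
  obtain ⟨R, hR1, hR2⟩ := exists_between hω4
  have hfr := frequently_lt_of_liminf_lt (by isBoundedDefault) hR1
  have hBfin : ({z | f z ≤ R.toReal ^ (p⁻¹)} ∩ {z | a < f z}).Finite :=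
    (hfinf _).subset inter_subset_left
  have hev : ∀ᶠ n in atTop, ∀ z ∈ ({z | f z ≤ R.toReal ^ (p⁻¹)} ∩ {z | a < f z}),
      D (M.jump n ω) (M.J n ω) < D z 0 := by
    rw [eventually_all_finite hBfin]
    intro z hz
    refine hD0.eventually_lt_const ?_
    have hz2 : a < f z := hz.2
    have h6 : 0 < f z := ha.trans hz2
    have h7 := M.γ_pos z
    simp only [hD, ENNReal.ofReal_pos]
    positivity
  obtain ⟨n, hn1, hn2⟩ := (hfr.and_eventually hev).exists
  refine lt_irrefl _ (hn2 (M.jump n ω) ⟨?_, ?_⟩)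
  · have h6 : f (M.jump n ω) ^ p ≤ R.toReal := by
      have := (ENNReal.ofReal_lt_iff_lt_toReal (Real.rpow_nonneg (hf _) _) hR2.ne).1 hn1
      exact this.le
    have h7 := Real.rpow_le_rpow (Real.rpow_nonneg (hf _) _) h6 (z := p⁻¹) (by positivity)
    rwa [Real.rpow_rpow_inv (hf _) (by linarith)] at h7
  · have h8 : ¬ f (M.jump n ω) ≤ a := hal n n le_rfl
    exact not_le.1 h8

lemma main_bound (M : CTMC) (f : M.X → ℝ) (hf : ∀ x, 0 ≤ f x) (hfinf : M.FinSublevels f)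
    (p a : ℝ) (hp : 2 ≤ p) (ha : 0 < a)
    (hfp : M.InDom fun x => f x ^ p) (c : ℝ) (hc : 0 < c)
    (hdrift : ∀ x : M.X, a < f x → M.gen (fun y => f y ^ p) x ≤ -(c * f x ^ (p - 2)))
    (ε : ℝ) (hε0 : 0 < ε) (hε : p / 2 * ε = c)
    (x : M.X) (hx : a < f x) :
    ∫⁻ ω, M.tau {y | f y ≤ a} ω ^ (p / 2) ∂(M.μ x) ≤
      ENNReal.ofReal (ε ^ (-(p / 2))) * ENNReal.ofReal (f x ^ p) := by
  have hh := M.ae_hits f hf hfinf p a hp ha hfp c hc hdrift x hx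
  set A : Set M.X := {y | f y ≤ a} with hA
  set V : M.X → ℝ → ℝ≥0∞ := fun y s => ENNReal.ofReal ((f y ^ 2 + ε * s) ^ (p / 2)) with hV
  set D : M.X → ℝ → ℝ≥0∞ := fun y _ => 0 with hD
  have hVmeas : ∀ y, Measurable (V y) := fun y => by simp only [hV]; fun_prop
  have hb := M.sum_bound A x V D hVmeas (fun y => measurable_const)
    (fun y hy s hs => by
      simp only [hD, add_zero]
      exact M.V2_drift f p c hp hf hc hfp y (ha.trans (not_le.1 hy)) (hdrift y (not_le.1 hy))
        ε hε s hs)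
  have hmi : ∀ n, Measurable ((M.hits A n).indicator
      fun ω => V (M.jump (n + 1) ω) (M.J (n + 1) ω)) := fun n =>
    (M.measurable_comp_jump (n + 1) V hVmeas).indicator (M.measurableSet_hits A n)
  have h1 : ∫⁻ ω, ∑' n, (M.hits A n).indicator
      (fun ω => V (M.jump (n + 1) ω) (M.J (n + 1) ω)) ω ∂(M.μ x) ≤ V x 0 := by
    rw [lintegral_tsum fun n => (hmi n).aemeasurable]
    refine ENNReal.tsum_le_of_sum_range_le fun m => ?_
    refine le_trans ?_ (hb m)
    refine le_trans (Finset.sum_le_sum fun n _ => ?_) le_self_add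
    rw [lintegral_indicator (M.measurableSet_hits A n)]
    exact le_self_add
  have hVx : V x 0 = ENNReal.ofReal (f x ^ p) := by
    simp only [hV, mul_zero, add_zero]
    rw [sq_rpow_half (hf x)]
  rw [← hVx]
  refine le_trans ?_ (mul_le_mul_right h1 _)
  rw [← lintegral_const_mul _ (Measurable.ennreal_tsum hmi)]
  refine lintegral_mono_ae ?_
  filter_upwards [hh] with ω ⟨n, hn⟩
  have h2 : V (M.jump (n + 1) ω) (M.J (n + 1) ω) ≤ ∑' n, (M.hits A n).indicator
      (fun ω => V (M.jump (n + 1) ω) (M.J (n + 1) ω)) ω := by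
    refine le_trans (le_of_eq ?_) (ENNReal.le_tsum n)
    rw [indicator_of_mem hn]
  refine le_trans ?_ (mul_le_mul_right h2 _)
  have hJ := M.J_nonneg (n + 1) ω
  calc M.tau A ω ^ (p / 2) ≤ ENNReal.ofReal (M.J (n + 1) ω) ^ (p / 2) :=
        ENNReal.rpow_le_rpow (M.tau_le A (n + 1) ω hn.2) (by linarith)
    _ = ENNReal.ofReal (M.J (n + 1) ω ^ (p / 2)) :=
        ENNReal.ofReal_rpow_of_nonneg hJ (by linarith)
    _ = ENNReal.ofReal (ε ^ (-(p / 2))) * ENNReal.ofReal ((ε * M.J (n + 1) ω) ^ (p / 2)) := by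
        rw [← ENNReal.ofReal_mul (by positivity), Real.mul_rpow hε0.le hJ, ← mul_assoc,
          ← Real.rpow_add hε0]
        simp
    _ ≤ _ := by
        simp only [hV]
        gcongr
        nlinarith [sq_nonneg (f (M.jump (n + 1) ω))]

end CTMC

open CTMC in
/-- Corollary: under the drift condition `Γ f^p ≤ -c f^(p-2)` off `{f ≤ a}`
(`p ≥ 2`), there is a constant `c' > 0` with
`E_x (τ_{{f ≤ a}}^q) ≤ c' f(x)^{2q}` for all `0 < q ≤ p/2` and all `x`. -/
theorem statement12 (M : CTMC) (f : M.X → ℝ) (hf : M.InDomPos f) (hfinf : M.FinSublevels f)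
    (p a : ℝ) (hp : 2 ≤ p) (ha : 0 < a)
    (hfp : M.InDomPos fun x => f x ^ p) (c : ℝ) (hc : 0 < c)
    (hdrift : ∀ x : M.X, a < f x → M.gen (fun y => f y ^ p) x ≤ -c * f x ^ (p - 2)) :
    ∃ c' : ℝ, 0 < c' ∧ ∀ q : ℝ, 0 < q → q ≤ p / 2 → ∀ x : M.X,
      ∫⁻ ω, M.tau {y | f y ≤ a} ω ^ q ∂ M.μ x ≤ ENNReal.ofReal (c' * f x ^ (2 * q)) := by
  have hdrift' : ∀ x : M.X, a < f x →
      M.gen (fun y => f y ^ p) x ≤ -(c * f x ^ (p - 2)) := fun x hx => by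
    have := hdrift x hx
    linarith
  set ε : ℝ := c / (p / 2) with hεdef
  have hp2 : 0 < p / 2 := by linarith
  have hε0 : 0 < ε := by positivity
  have hε : p / 2 * ε = c := by rw [hεdef]; field_simp
  refine ⟨1 + ε ^ (-(p / 2)), by positivity, fun q hq hqp x => ?_⟩
  by_cases hx : a < f x
  · have hmain := M.main_bound f hf.1 hfinf p a hp ha hfp.2 c hc hdrift' ε hε0 hε x hx
    have hfx : 0 < f x := ha.trans hx
    have hL : 0 < f x ^ 2 := by positivity
    calc ∫⁻ ω, M.tau {y | f y ≤ a} ω ^ q ∂ M.μ x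
        ≤ ∫⁻ ω, (ENNReal.ofReal ((f x ^ 2) ^ q) + ENNReal.ofReal ((f x ^ 2) ^ (q - p / 2)) *
            M.tau {y | f y ≤ a} ω ^ (p / 2)) ∂ M.μ x :=
          lintegral_mono fun ω => young hL hq hqp _
      _ = ENNReal.ofReal ((f x ^ 2) ^ q) + ENNReal.ofReal ((f x ^ 2) ^ (q - p / 2)) *
            ∫⁻ ω, M.tau {y | f y ≤ a} ω ^ (p / 2) ∂ M.μ x := by
          rw [lintegral_add_left measurable_const, lintegral_const_mul' _ _ ENNReal.ofReal_ne_top]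
          simp
      _ ≤ ENNReal.ofReal ((f x ^ 2) ^ q) + ENNReal.ofReal ((f x ^ 2) ^ (q - p / 2)) *
            (ENNReal.ofReal (ε ^ (-(p / 2))) * ENNReal.ofReal (f x ^ p)) := by
          gcongr
      _ = _ := by
          rw [← ENNReal.ofReal_mul (by positivity), ← ENNReal.ofReal_mul (by positivity),
            ← ENNReal.ofReal_add (by positivity) (by positivity)]
          congr 1
          have e1 : (f x ^ 2) ^ q = f x ^ (2 * q) := by
            rw [← sq_rpow_half hfx.le (2 * q)]; congr 1; ring
          have e2 : (f x ^ 2) ^ (q - p / 2) * f x ^ p = (f x ^ 2) ^ q := by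
            rw [← sq_rpow_half hfx.le p, ← Real.rpow_add hL]; congr 1; ring
          rw [← e1]
          linear_combination ε ^ (-(p / 2)) * e2
  · have h5 : ∀ᵐ ω ∂(M.μ x), M.jump 0 ω = x :=
      (prob_compl_eq_zero_iff (M.jump_meas 0 x)).2 (M.start x)
    have : ∫⁻ ω, M.tau {y | f y ≤ a} ω ^ q ∂ M.μ x = 0 := by
      rw [lintegral_congr_ae (g := fun _ => 0)]
      · simp
      · filter_upwards [h5] with ω hω
        have h6 := M.tau_le {y | f y ≤ a} 0 ω (by rw [hω]; exact not_lt.1 hx)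
        have h7 : M.J 0 ω = 0 := by simp [J]
        rw [h7, ENNReal.ofReal_zero] at h6
        rw [le_antisymm h6 bot_le]
        exact ENNReal.zero_rpow_of_pos hq
    rw [this]
    exact bot_le
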